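/- For every integer n ≥ 2 there exists a symmetric n² × n² real matrix A with A ≠ 0 such that ‖𝒯_{n²}(A)‖_opr ≥ (4/(5π))·(log n)·‖A‖_opr, where log denotes the natural logarithm. (One may take A = A_n ⊗ A_n, the Kronecker square of the matrix A_n with (A_n)_{ij} = 0 for i = j and 1/(i−j) for i ≠ j.) -/

import Mathlib

open MeasureTheory Filter

/-- The `ℓ² → ℓ²` operator norm of an `n × n` real matrix:
`sup_{‖x‖₂ ≤ 1} ‖Ax‖₂`. -/
noncomputable def oprNorm {n : ℕ} (A : Matrix (Fin n) (Fin n) ℝ) : ℝ :=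
  sSup {r : ℝ | ∃ x : Fin n → ℝ, (∑ j, (x j) ^ 2) ≤ 1 ∧
    r = Real.sqrt (∑ i, (∑ j, A i j * x j) ^ 2)}
/-- Triangular cut `𝒯_n(A) = A ∘ T_n`, where `(T_n)_{ij} = 1` if `i ≥ j` and `0` if `i < j`:
entries with `i < j` are set to zero. -/
def tri {n : ℕ} (A : Matrix (Fin n) (Fin n) ℝ) : Matrix (Fin n) (Fin n) ℝ :=
  fun i j => if j ≤ i then A i j else 0
/-- Kronecker (tensor) product of two `n × n` matrices, as an `n² × n²` matrix with
lexicographic indexing: the entry at `(i*n + k, j*n + l)` is `A i j * B k l`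
(`finProdFinEquiv (i,k) = i*n + k`). -/
noncomputable def kron {n : ℕ} (A B : Matrix (Fin n) (Fin n) ℝ) :
    Matrix (Fin (n * n)) (Fin (n * n)) ℝ :=
  Matrix.reindex finProdFinEquiv finProdFinEquiv (Matrix.kroneckerMap (· * ·) A B)

lemma oprNorm_nonneg {n : ℕ} (A : Matrix (Fin n) (Fin n) ℝ) : 0 ≤ oprNorm A := by
  refine Real.sSup_nonneg ?_
  rintro r ⟨x, -, rfl⟩
  exact Real.sqrt_nonneg _

lemma oprNorm_le {n : ℕ} {A : Matrix (Fin n) (Fin n) ℝ} {c : ℝ} (hc : 0 ≤ c)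
    (h : ∀ x : Fin n → ℝ, ∑ i, (∑ j, A i j * x j) ^ 2 ≤ c ^ 2 * ∑ j, x j ^ 2) :
    oprNorm A ≤ c := by
  refine Real.sSup_le ?_ hc
  rintro r ⟨x, hx, rfl⟩
  refine Real.sqrt_le_iff.2 ⟨hc, (h x).trans ?_⟩
  exact mul_le_of_le_one_right (sq_nonneg c) hx

lemma le_oprNorm {n : ℕ} {A : Matrix (Fin n) (Fin n) ℝ} {c : ℝ} (x : Fin n → ℝ)
    (hx : ∑ j, x j ^ 2 ≤ 1) (h : c ^ 2 ≤ ∑ i, (∑ j, A i j * x j) ^ 2) :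
    c ≤ oprNorm A := by
  refine (Real.le_sqrt_of_sq_le h).trans (le_csSup ?_ ⟨x, hx, rfl⟩)
  refine ⟨Real.sqrt (∑ i, ∑ j, A i j ^ 2), ?_⟩
  rintro r ⟨y, hy, rfl⟩
  refine Real.sqrt_le_sqrt (Finset.sum_le_sum fun i _ => ?_)
  refine (Finset.sum_mul_sq_le_sq_mul_sq _ _ _).trans ?_
  exact mul_le_of_le_one_right (Finset.sum_nonneg fun j _ => sq_nonneg _) hy

lemma sum_finProd {n : ℕ} (f : Fin (n * n) → ℝ) :
    ∑ p, f p = ∑ i : Fin n, ∑ k : Fin n, f (finProdFinEquiv (i, k)) := by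
  rw [← Equiv.sum_comp finProdFinEquiv f, Fintype.sum_prod_type]

lemma kron_apply {n : ℕ} (A B : Matrix (Fin n) (Fin n) ℝ) (i k j l : Fin n) :
    kron A B (finProdFinEquiv (i, k)) (finProdFinEquiv (j, l)) = A i j * B k l := by
  simp [kron]

lemma kron_sum_mul {n : ℕ} (A B : Matrix (Fin n) (Fin n) ℝ) (x : Fin (n * n) → ℝ)
    (i k : Fin n) :
    ∑ q, kron A B (finProdFinEquiv (i, k)) q * x q =
      ∑ j, A i j * ∑ l, B k l * x (finProdFinEquiv (j, l)) := by
  rw [sum_finProd]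
  refine Finset.sum_congr rfl fun j _ => ?_
  rw [Finset.mul_sum]
  exact Finset.sum_congr rfl fun l _ => by rw [kron_apply, mul_assoc]

lemma kron_sum_sq_le {n : ℕ} {A B : Matrix (Fin n) (Fin n) ℝ} {a b : ℝ}
    (hA : ∀ x : Fin n → ℝ, ∑ i, (∑ j, A i j * x j) ^ 2 ≤ a ^ 2 * ∑ j, x j ^ 2)
    (hB : ∀ x : Fin n → ℝ, ∑ i, (∑ j, B i j * x j) ^ 2 ≤ b ^ 2 * ∑ j, x j ^ 2)
    (x : Fin (n * n) → ℝ) :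
    ∑ p, (∑ q, kron A B p q * x q) ^ 2 ≤ (a * b) ^ 2 * ∑ q, x q ^ 2 := by
  rw [sum_finProd, sum_finProd]
  simp only [kron_sum_mul]
  rw [Finset.sum_comm]
  calc _ ≤ ∑ k, a ^ 2 * ∑ j, (∑ l, B k l * x (finProdFinEquiv (j, l))) ^ 2 :=
        Finset.sum_le_sum fun k _ => hA _
    _ = a ^ 2 * ∑ j, ∑ k, (∑ l, B k l * x (finProdFinEquiv (j, l))) ^ 2 := by
        rw [← Finset.mul_sum, Finset.sum_comm]
    _ ≤ a ^ 2 * ∑ j, b ^ 2 * ∑ l, x (finProdFinEquiv (j, l)) ^ 2 := by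
        gcongr with j _
        exact hB _
    _ = _ := by rw [← Finset.mul_sum]; ring

lemma kron_isSymm_of_antisymm {n : ℕ} {A B : Matrix (Fin n) (Fin n) ℝ}
    (hA : ∀ i j, A j i = -A i j) (hB : ∀ i j, B j i = -B i j) : (kron A B).IsSymm := by
  refine Matrix.IsSymm.ext fun p q => ?_
  obtain ⟨⟨i, k⟩, rfl⟩ := finProdFinEquiv.surjective p
  obtain ⟨⟨j, l⟩, rfl⟩ := finProdFinEquiv.surjective q
  rw [kron_apply, kron_apply, hA i j, hB k l, neg_mul_neg]

lemma tri_kron {n : ℕ} {A : Matrix (Fin n) (Fin n) ℝ} (B : Matrix (Fin n) (Fin n) ℝ)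
    (hA : ∀ i, A i i = 0) : tri (kron A B) = kron (tri A) B := by
  ext p q
  obtain ⟨⟨i, k⟩, rfl⟩ := finProdFinEquiv.surjective p
  obtain ⟨⟨j, l⟩, rfl⟩ := finProdFinEquiv.surjective q
  simp only [tri, kron_apply]
  have key : ∀ {i j : Fin n} (k l : Fin n), j < i →
      finProdFinEquiv (j, l) < finProdFinEquiv (i, k) := by
    intro i j k l h
    rw [Fin.lt_def, finProdFinEquiv_apply_val, finProdFinEquiv_apply_val]
    have h1 : (j : ℕ) + 1 ≤ i := h
    have h2 := Nat.mul_le_mul_left n h1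
    have h3 := l.isLt
    linarith
  rcases lt_trichotomy i j with h | rfl | h
  · rw [if_neg (not_le.2 (key l k h)), if_neg (not_le.2 h), zero_mul]
  · simp [hA]
  · rw [if_pos (key k l h).le, if_pos h.le]

/-- The matrix with entries `1 / (i - j)` off the diagonal and `0` on it. -/
noncomputable def hilbertMatrix (n : ℕ) : Matrix (Fin n) (Fin n) ℝ :=
  fun i j => ((i : ℝ) - j)⁻¹

lemma integral_cos_intCast_mul (m : ℤ) :
    ∫ t in (0 : ℝ)..(2 * Real.pi), Real.cos (m * t) = if m = 0 then 2 * Real.pi else 0 := by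
  split_ifs with hm
  · simp [hm]
  · have hm' : (m : ℝ) ≠ 0 := by exact_mod_cast hm
    have hs : Real.sin (m * (2 * Real.pi)) = 0 := by
      have := Real.sin_int_mul_pi (m * 2)
      push_cast at this
      rwa [mul_assoc] at this
    rw [intervalIntegral.integral_comp_mul_left (fun t => Real.cos t) hm', integral_cos, hs]
    simp

lemma integral_pi_sub_mul_sin_intCast_mul (m : ℤ) :
    ∫ t in (0 : ℝ)..(2 * Real.pi), (Real.pi - t) * Real.sin (m * t) =
      2 * Real.pi * (m : ℝ)⁻¹ := by
  rcases eq_or_ne m 0 with rfl | hm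
  · simp
  have hm' : (m : ℝ) ≠ 0 := by exact_mod_cast hm
  have hs : Real.sin (m * (2 * Real.pi)) = 0 := by
    have := Real.sin_int_mul_pi (m * 2)
    push_cast at this
    rwa [mul_assoc] at this
  have hc : Real.cos (m * (2 * Real.pi)) = 1 := Real.cos_int_mul_two_pi m
  have hderiv : ∀ t ∈ Set.uIcc (0 : ℝ) (2 * Real.pi), HasDerivAt
      (fun t => -((Real.pi - t) * Real.cos (m * t) / m) - Real.sin (m * t) / (m : ℝ) ^ 2)
      ((Real.pi - t) * Real.sin (m * t)) t := by
    intro t _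
    have hl : HasDerivAt (fun t : ℝ => (m : ℝ) * t) m t := by
      simpa using (hasDerivAt_id t).const_mul (m : ℝ)
    have hp : HasDerivAt (fun t : ℝ => Real.pi - t) (-1) t := by
      simpa using (hasDerivAt_id t).const_sub Real.pi
    have h := (((hp.mul hl.cos).div_const (m : ℝ)).neg).sub (hl.sin.div_const ((m : ℝ) ^ 2))
    refine h.congr_deriv ?_
    field_simp
    ring
  rw [intervalIntegral.integral_eq_sub_of_hasDerivAt hderiv
    (Continuous.intervalIntegrable (by fun_prop) _ _), hs, hc]
  simp
  field_simp
  ring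

lemma integral_sum_cos_sq_add_sum_sin_sq {n : ℕ} (x : Fin n → ℝ) :
    ∫ t in (0 : ℝ)..(2 * Real.pi),
      ((∑ j, x j * Real.cos (j * t)) ^ 2 + (∑ j, x j * Real.sin (j * t)) ^ 2) =
      2 * Real.pi * ∑ j, x j ^ 2 := by
  have hexp : ∀ t : ℝ,
      (∑ j, x j * Real.cos (j * t)) ^ 2 + (∑ j, x j * Real.sin (j * t)) ^ 2 =
      ∑ i, ∑ j, x i * x j * Real.cos ((((i : ℕ) : ℤ) - ((j : ℕ) : ℤ) : ℤ) * t) := by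
    intro t
    rw [sq, sq, Finset.sum_mul_sum, Finset.sum_mul_sum, ← Finset.sum_add_distrib]
    refine Finset.sum_congr rfl fun i _ => ?_
    rw [← Finset.sum_add_distrib]
    refine Finset.sum_congr rfl fun j _ => ?_
    push_cast
    rw [sub_mul, Real.cos_sub]
    ring
  simp only [hexp]
  rw [intervalIntegral.integral_finsetSum
    fun i _ => Continuous.intervalIntegrable (by fun_prop) _ _, Finset.mul_sum]
  refine Finset.sum_congr rfl fun i _ => ?_
  rw [intervalIntegral.integral_finsetSum
    fun j _ => Continuous.intervalIntegrable (by fun_prop) _ _]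
  simp only [intervalIntegral.integral_const_mul, integral_cos_intCast_mul, sub_eq_zero,
    Nat.cast_inj, Fin.val_inj, mul_ite, mul_zero, Finset.sum_ite_eq, Finset.mem_univ, if_true]
  ring

lemma integral_sum_sin_mul_sum_cos_sub {n : ℕ} (x y : Fin n → ℝ) :
    ∫ t in (0 : ℝ)..(2 * Real.pi), (Real.pi - t) *
      ((∑ i, y i * Real.sin (i * t)) * (∑ j, x j * Real.cos (j * t)) -
        (∑ i, y i * Real.cos (i * t)) * (∑ j, x j * Real.sin (j * t))) =
      2 * Real.pi * ∑ i, y i * ∑ j, hilbertMatrix n i j * x j := by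
  have hexp : ∀ t : ℝ, (Real.pi - t) *
      ((∑ i, y i * Real.sin (i * t)) * (∑ j, x j * Real.cos (j * t)) -
        (∑ i, y i * Real.cos (i * t)) * (∑ j, x j * Real.sin (j * t))) =
      ∑ i, ∑ j, y i * x j *
        ((Real.pi - t) * Real.sin ((((i : ℕ) : ℤ) - ((j : ℕ) : ℤ) : ℤ) * t)) := by
    intro t
    rw [Finset.sum_mul_sum, Finset.sum_mul_sum, ← Finset.sum_sub_distrib, Finset.mul_sum]
    refine Finset.sum_congr rfl fun i _ => ?_
    rw [← Finset.sum_sub_distrib, Finset.mul_sum]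
    refine Finset.sum_congr rfl fun j _ => ?_
    push_cast
    rw [sub_mul (i : ℝ), Real.sin_sub]
    ring
  simp only [hexp]
  rw [intervalIntegral.integral_finsetSum
    fun i _ => Continuous.intervalIntegrable (by fun_prop) _ _, Finset.mul_sum]
  refine Finset.sum_congr rfl fun i _ => ?_
  rw [intervalIntegral.integral_finsetSum
    fun j _ => Continuous.intervalIntegrable (by fun_prop) _ _, Finset.mul_sum, Finset.mul_sum]
  refine Finset.sum_congr rfl fun j _ => ?_
  rw [intervalIntegral.integral_const_mul, integral_pi_sub_mul_sin_intCast_mul, hilbertMatrix]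
  push_cast
  ring

/-- Hilbert's inequality in bilinear form, with the arithmetic mean of the squared norms. -/
lemma hilbertMatrix_bilinear_le {n : ℕ} (x y : Fin n → ℝ) :
    ∑ i, y i * ∑ j, hilbertMatrix n i j * x j ≤
      Real.pi / 2 * (∑ j, x j ^ 2 + ∑ j, y j ^ 2) := by
  have hpi := Real.pi_pos
  have hmono := intervalIntegral.integral_mono_on (μ := volume) (a := 0) (b := 2 * Real.pi)
    (f := fun t => (Real.pi - t) *
      ((∑ i, y i * Real.sin (i * t)) * (∑ j, x j * Real.cos (j * t)) -
        (∑ i, y i * Real.cos (i * t)) * (∑ j, x j * Real.sin (j * t))))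
    (g := fun t => Real.pi / 2 *
      (((∑ j, x j * Real.cos (j * t)) ^ 2 + (∑ j, x j * Real.sin (j * t)) ^ 2) +
        ((∑ j, y j * Real.cos (j * t)) ^ 2 + (∑ j, y j * Real.sin (j * t)) ^ 2)))
    (by positivity) (Continuous.intervalIntegrable (by fun_prop) _ _)
    (Continuous.intervalIntegrable (by fun_prop) _ _) (by
      rintro t ⟨h0, h1⟩
      generalize (∑ j, x j * Real.cos (j * t)) = c
      generalize (∑ j, x j * Real.sin (j * t)) = s
      generalize (∑ j, y j * Real.cos (j * t)) = c'
      generalize (∑ j, y j * Real.sin (j * t)) = s'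
      have hp : |Real.pi - t| ≤ Real.pi := abs_le.2 ⟨by linarith, by linarith⟩
      have hq : |s' * c - c' * s| ≤ (c ^ 2 + s ^ 2 + (c' ^ 2 + s' ^ 2)) / 2 :=
        abs_le.2 ⟨by nlinarith [sq_nonneg (s' + c), sq_nonneg (c' - s)],
          by nlinarith [sq_nonneg (s' - c), sq_nonneg (c' + s)]⟩
      calc _ ≤ |(Real.pi - t) * (s' * c - c' * s)| := le_abs_self _
        _ = |Real.pi - t| * |s' * c - c' * s| := abs_mul _ _
        _ ≤ Real.pi * ((c ^ 2 + s ^ 2 + (c' ^ 2 + s' ^ 2)) / 2) := by gcongr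
        _ = _ := by ring)
  rw [integral_sum_sin_mul_sum_cos_sub, intervalIntegral.integral_const_mul,
    intervalIntegral.integral_add (Continuous.intervalIntegrable (by fun_prop) _ _)
      (Continuous.intervalIntegrable (by fun_prop) _ _),
    integral_sum_cos_sq_add_sum_sin_sq, integral_sum_cos_sq_add_sum_sin_sq] at hmono
  refine le_of_mul_le_mul_left (hmono.trans_eq ?_) (by positivity : 0 < 2 * Real.pi)
  ring

/-- Hilbert's inequality with the constant `π`. -/
lemma hilbertMatrix_sum_sq_le {n : ℕ} (x : Fin n → ℝ) :
    ∑ i, (∑ j, hilbertMatrix n i j * x j) ^ 2 ≤ Real.pi ^ 2 * ∑ j, x j ^ 2 := by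
  have hpi := Real.pi_pos
  set S := ∑ i, (∑ j, hilbertMatrix n i j * x j) ^ 2 with hS
  have h := hilbertMatrix_bilinear_le x
    (fun i => Real.pi⁻¹ * ∑ j, hilbertMatrix n i j * x j)
  have e1 : ∑ i, Real.pi⁻¹ * (∑ j, hilbertMatrix n i j * x j) *
      (∑ j, hilbertMatrix n i j * x j) = Real.pi⁻¹ * S := by
    rw [hS, Finset.mul_sum]
    exact Finset.sum_congr rfl fun i _ => by ring
  have e2 : ∑ i, (Real.pi⁻¹ * ∑ j, hilbertMatrix n i j * x j) ^ 2 = Real.pi⁻¹ ^ 2 * S := by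
    rw [hS, Finset.mul_sum]
    exact Finset.sum_congr rfl fun i _ => by ring
  rw [e1, e2] at h
  have h' := mul_le_mul_of_nonneg_left h (by positivity : 0 ≤ 2 * Real.pi)
  have e3 : 2 * Real.pi * (Real.pi⁻¹ * S) = 2 * S := by field_simp
  have e4 : 2 * Real.pi * (Real.pi / 2 * (∑ j, x j ^ 2 + Real.pi⁻¹ ^ 2 * S)) =
      Real.pi ^ 2 * ∑ j, x j ^ 2 + S := by field_simp
  linarith

lemma sum_tri_hilbertMatrix {n : ℕ} (i : Fin n) :
    ∑ j, tri (hilbertMatrix n) i j = harmonic i := by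
  have h1 : ∑ j, tri (hilbertMatrix n) i j =
      ∑ j ∈ Finset.range n, if j ≤ (i : ℕ) then ((i : ℝ) - j)⁻¹ else 0 := by
    rw [Finset.sum_range]
    rfl
  have h2 : (Finset.range n).filter (· ≤ (i : ℕ)) = Finset.range (i + 1) := by
    ext j
    have := i.isLt
    simp
    omega
  rw [h1, ← Finset.sum_filter, h2, Finset.sum_range_succ, sub_self, inv_zero, add_zero,
    ← Finset.sum_range_reflect, harmonic]
  push_cast
  refine Finset.sum_congr rfl fun j hj => ?_
  have hj' : j + 1 ≤ (i : ℕ) := Finset.mem_range.1 hj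
  rw [Nat.sub_sub, add_comm 1 j, Nat.cast_sub hj']
  push_cast
  congr 1
  ring

lemma sum_range_harmonic (n : ℕ) :
    ∑ i ∈ Finset.range n, (harmonic i : ℝ) = n * harmonic n - n := by
  induction n with
  | zero => simp
  | succ n ih =>
    rw [Finset.sum_range_succ, ih, harmonic_succ]
    push_cast
    field_simp
    ring

/-- The antisymmetric matrix supported on the coordinates `a` and `b`, rotating the plane they
span by a right angle. -/
def planeRotation {n : ℕ} (a b : Fin n) : Matrix (Fin n) (Fin n) ℝ :=
  fun k l => (if k = b ∧ l = a then 1 else 0) - (if k = a ∧ l = b then 1 else 0)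

lemma planeRotation_sum_mul {n : ℕ} (a b : Fin n) (x : Fin n → ℝ) (k : Fin n) :
    ∑ l, planeRotation a b k l * x l =
      (if k = b then x a else 0) - (if k = a then x b else 0) := by
  simp [planeRotation, sub_mul, Finset.sum_sub_distrib, ite_and]

lemma planeRotation_sum_sq_le {n : ℕ} {a b : Fin n} (hab : a ≠ b) (x : Fin n → ℝ) :
    ∑ k, (∑ l, planeRotation a b k l * x l) ^ 2 ≤ 1 ^ 2 * ∑ l, x l ^ 2 := by
  have h : ∀ k, (∑ l, planeRotation a b k l * x l) ^ 2 =
      (if k = b then x a ^ 2 else 0) + (if k = a then x b ^ 2 else 0) := by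
    intro k
    rw [planeRotation_sum_mul]
    by_cases hk : k = b
    · simp [hk, hab.symm]
    · by_cases hk' : k = a <;> simp [hk, hk', hab]
  simp only [h, Finset.sum_add_distrib, Finset.sum_ite_eq', Finset.mem_univ, if_true, one_pow,
    one_mul]
  rw [← Finset.sum_pair (f := fun l => x l ^ 2) hab]
  exact Finset.sum_le_sum_of_subset_of_nonneg (Finset.subset_univ _) fun l _ _ => sq_nonneg _

lemma harmonic_sub_one_le_oprNorm_tri {n : ℕ} {a b : Fin n} (hab : a ≠ b) :
    (harmonic n : ℝ) - 1 ≤ oprNorm (tri (kron (hilbertMatrix n) (planeRotation a b))) := by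
  have hn : (0 : ℝ) < n := by exact_mod_cast a.pos
  rw [tri_kron _ fun i => by simp [hilbertMatrix]]
  have hsq : (Real.sqrt n)⁻¹ ^ 2 = (n : ℝ)⁻¹ := by rw [inv_pow, Real.sq_sqrt hn.le]
  refine le_oprNorm
    (fun q => if (finProdFinEquiv.symm q).2 = a then (Real.sqrt n)⁻¹ else 0) ?_ ?_
  · rw [sum_finProd]
    simp [ite_pow, hsq, hn.ne']
  · rw [sum_finProd]
    simp only [kron_sum_mul, planeRotation_sum_mul, Equiv.symm_apply_apply, if_true, hab.symm,
      if_false]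
    calc ((harmonic n : ℝ) - 1) ^ 2
        = (n : ℝ)⁻¹ * ((n : ℝ)⁻¹ * (∑ i : Fin n, (harmonic i : ℝ)) ^ 2) := by
          rw [Fin.sum_univ_eq_sum_range (fun i => (harmonic i : ℝ)), sum_range_harmonic]
          field_simp
      _ ≤ (n : ℝ)⁻¹ * ∑ i : Fin n, (harmonic i : ℝ) ^ 2 := by
          gcongr
          rw [inv_mul_le_iff₀ hn]
          simpa using sq_sum_le_card_mul_sum_sq (s := Finset.univ)
            (f := fun i : Fin n => (harmonic i : ℝ))
      _ = ∑ i : Fin n, (∑ j, tri (hilbertMatrix n) i j * (Real.sqrt n)⁻¹) ^ 2 := by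
          rw [Finset.mul_sum]
          refine Finset.sum_congr rfl fun i _ => ?_
          rw [← Finset.sum_mul, sum_tri_hilbertMatrix, mul_pow, hsq, mul_comm]
      _ ≤ _ := by
          refine Finset.sum_le_sum fun i _ => ?_
          refine le_trans (le_of_eq ?_) (Finset.single_le_sum (fun k _ => sq_nonneg _)
            (Finset.mem_univ b))
          simp [hab.symm]

lemma tri_one {n : ℕ} : tri (1 : Matrix (Fin n) (Fin n) ℝ) = 1 := by
  ext i j
  by_cases h : i = j <;> simp [tri, h]

lemma log_add_half_lt_harmonic {n : ℕ} (hn : n ≠ 0) : Real.log n + 1 / 2 < harmonic n := by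
  have h1 := Real.eulerMascheroniConstant_lt_eulerMascheroniSeq' n
  have h2 := Real.one_half_lt_eulerMascheroniConstant
  rw [Real.eulerMascheroniSeq', if_neg hn] at h1
  linarith

/-- For every `n ≥ 2` there exists a nonzero symmetric `n² × n²` real
matrix `A` with `‖𝒯_{n²}(A)‖_opr ≥ (4/(5π))·(log n)·‖A‖_opr`. -/
theorem triCut_oprNorm_symm_witness (n : ℕ) (hn : 2 ≤ n) :
    ∃ A : Matrix (Fin (n * n)) (Fin (n * n)) ℝ, A.IsSymm ∧ A ≠ 0 ∧
      oprNorm (tri A) ≥ (4 / (5 * Real.pi)) * Real.log n * oprNorm A := by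
  have hpi := Real.pi_pos
  rcases le_total (Real.log n) (5 / 2) with hlog | hlog
  · have : NeZero (n * n) := ⟨by positivity⟩
    refine ⟨1, Matrix.isSymm_one, one_ne_zero, ?_⟩
    rw [tri_one]
    refine mul_le_of_le_one_left (oprNorm_nonneg _) ?_
    rw [div_mul_eq_mul_div, div_le_one (by positivity)]
    linarith [Real.pi_gt_three]
  · have hab : (⟨0, by omega⟩ : Fin n) ≠ ⟨1, by omega⟩ := by simp
    refine ⟨kron (hilbertMatrix n) (planeRotation ⟨0, by omega⟩ ⟨1, by omega⟩), ?_, ?_, ?_⟩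
    · refine kron_isSymm_of_antisymm (fun i j => ?_) (fun k l => ?_)
      · rw [hilbertMatrix, hilbertMatrix, ← inv_neg, neg_sub]
      · simp only [planeRotation, neg_sub, and_comm]
    · intro h
      have h' := congrFun (congrFun h (finProdFinEquiv (⟨1, by omega⟩, ⟨1, by omega⟩)))
        (finProdFinEquiv (⟨0, by omega⟩, ⟨0, by omega⟩))
      rw [kron_apply] at h'
      simp [hilbertMatrix, planeRotation] at h'
    · have hupper := oprNorm_le (by positivity)
        (kron_sum_sq_le hilbertMatrix_sum_sq_le (planeRotation_sum_sq_le hab))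
      rw [mul_one] at hupper
      have hlower := harmonic_sub_one_le_oprNorm_tri hab
      have hharm := log_add_half_lt_harmonic (n := n) (by omega)
      have hmul := mul_le_mul_of_nonneg_left hupper
        (by positivity : 0 ≤ 4 / (5 * Real.pi) * Real.log n)
      have e : 4 / (5 * Real.pi) * Real.log n * Real.pi = 4 / 5 * Real.log n := by field_simp
      rw [e] at hmul
      linarith
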